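/- Let (L, d_L, [−,−]_L) be a DG Lie algebra over a field k with Lie bracket of degree p, and let S(L) be the associated DG Poisson algebra (the graded symmetric algebra with extended differential and Poisson bracket of degree p). Let L ⋊ L be the graded semidirect product: L ⋊ L = L ⊕ L as graded vector spaces, with componentwise differential, where the Lie bracket is 0 on the first copy L + 0, equals the bracket of L on the second copy 0 + L, and from the pair of components 0 + L and L + 0 the bracket lands in L + 0 via the adjoint action [0+a, x+0] = [a,x]_L + 0. Let U(L ⋊ L) be the graded universal enveloping algebra of L ⋊ L, the quotient of the tensor algebra T(L ⋊ L) by the relations u⊗v − (−1)^{‖u‖‖v‖} v⊗u − [u,v] for homogeneous u, v ∈ L ⋊ L, where the U-degree is ‖x+0‖ = |x| on the first copy and ‖0+a‖ = |a| + p on the second copy, with the differential induced by d_L on both copies. Then there is an isomorphism of DG algebras Φ : S(L)^{ue} → U(L ⋊ L) with Φ(M_a) = a + 0 and Φ(H_a) = 0 + a for all a ∈ L. -/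

import Mathlib

noncomputable section

/-- A (graded-commutative) DG Poisson algebra structure, with Poisson bracket of degree `p`,
on a `ℤ`-graded `k`-algebra `A` with grading `𝒜`, differential `dA` and bracket `br`.
All axioms are stated for homogeneous elements, and signs are the Koszul signs. -/
structure IsDGPoissonAlgebra (k : Type) [Field k] (A : Type) [Ring A] [Algebra k A]
    (𝒜 : ℤ → Submodule k A) (dA : A →ₗ[k] A)
    (br : A →ₗ[k] A →ₗ[k] A) (p : ℤ) : Prop where
  comm : ∀ (i j : ℤ) (a b : A), a ∈ 𝒜 i → b ∈ 𝒜 j →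
    a * b = ((-1 : k) ^ (i * j)) • (b * a)
  d_mem : ∀ (i : ℤ) (a : A), a ∈ 𝒜 i → dA a ∈ 𝒜 (i + 1)
  d_sq : ∀ a : A, dA (dA a) = 0
  d_mul : ∀ (i j : ℤ) (a b : A), a ∈ 𝒜 i → b ∈ 𝒜 j →
    dA (a * b) = dA a * b + ((-1 : k) ^ i) • (a * dA b)
  br_mem : ∀ (i j : ℤ) (a b : A), a ∈ 𝒜 i → b ∈ 𝒜 j → br a b ∈ 𝒜 (i + j + p)
  antisymm : ∀ (i j : ℤ) (a b : A), a ∈ 𝒜 i → b ∈ 𝒜 j →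
    br a b = -(((-1 : k) ^ ((i + p) * (j + p))) • br b a)
  jacobi : ∀ (i j l : ℤ) (a b c : A), a ∈ 𝒜 i → b ∈ 𝒜 j → c ∈ 𝒜 l →
    br a (br b c) = br (br a b) c + ((-1 : k) ^ ((i + p) * (j + p))) • br b (br a c)
  d_br : ∀ (i j : ℤ) (a b : A), a ∈ 𝒜 i → b ∈ 𝒜 j →
    dA (br a b) = br (dA a) b + ((-1 : k) ^ (i + p)) • br a (dA b)
  poisson : ∀ (i j l : ℤ) (a b c : A), a ∈ 𝒜 i → b ∈ 𝒜 j → c ∈ 𝒜 l →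
    br a (b * c) = br a b * c + ((-1 : k) ^ ((i + p) * j)) • (b * br a c)

/-- A (not necessarily commutative) DG algebra structure on a `ℤ`-graded `k`-algebra. -/
structure IsDGAlgebra (k : Type) [Field k] (B : Type) [Ring B] [Algebra k B]
    (ℬ : ℤ → Submodule k B) (dB : B →ₗ[k] B) : Prop where
  graded_monoid : SetLike.GradedMonoid ℬ
  decomp : Nonempty (DirectSum.Decomposition ℬ)
  d_mem : ∀ (i : ℤ) (x : B), x ∈ ℬ i → dB x ∈ ℬ (i + 1)
  d_sq : ∀ x : B, dB (dB x) = 0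
  d_mul : ∀ (i j : ℤ) (x y : B), x ∈ ℬ i → y ∈ ℬ j →
    dB (x * y) = dB x * y + ((-1 : k) ^ i) • (x * dB y)
/-- The defining relations of the universal enveloping algebra of a DG Poisson algebra,
inside the free algebra (tensor algebra) on two copies `M_a = ι (a,0)`, `H_a = ι (0,a)`
of the underlying vector space of `A`. -/
inductive UERel (k : Type) [Field k] (A : Type) [Ring A] [Algebra k A]
    (𝒜 : ℤ → Submodule k A) (br : A →ₗ[k] A →ₗ[k] A) (p : ℤ) :
    TensorAlgebra k (A × A) → TensorAlgebra k (A × A) → Prop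
  | mul_M : ∀ (i j : ℤ) (a b : A), a ∈ 𝒜 i → b ∈ 𝒜 j →
      UERel k A 𝒜 br p (TensorAlgebra.ι k (a * b, (0 : A)))
        (TensorAlgebra.ι k (a, (0 : A)) * TensorAlgebra.ι k (b, (0 : A)))
  | br_H : ∀ (i j : ℤ) (a b : A), a ∈ 𝒜 i → b ∈ 𝒜 j →
      UERel k A 𝒜 br p (TensorAlgebra.ι k ((0 : A), br a b))
        (TensorAlgebra.ι k ((0 : A), a) * TensorAlgebra.ι k ((0 : A), b) -
          ((-1 : k) ^ ((i + p) * (j + p))) •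
            (TensorAlgebra.ι k ((0 : A), b) * TensorAlgebra.ι k ((0 : A), a)))
  | mul_H : ∀ (i j : ℤ) (a b : A), a ∈ 𝒜 i → b ∈ 𝒜 j →
      UERel k A 𝒜 br p (TensorAlgebra.ι k ((0 : A), a * b))
        (TensorAlgebra.ι k (a, (0 : A)) * TensorAlgebra.ι k ((0 : A), b) +
          ((-1 : k) ^ (i * j)) •
            (TensorAlgebra.ι k (b, (0 : A)) * TensorAlgebra.ι k ((0 : A), a)))
  | br_M : ∀ (i j : ℤ) (a b : A), a ∈ 𝒜 i → b ∈ 𝒜 j →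
      UERel k A 𝒜 br p (TensorAlgebra.ι k (br a b, (0 : A)))
        (TensorAlgebra.ι k ((0 : A), a) * TensorAlgebra.ι k (b, (0 : A)) -
          ((-1 : k) ^ ((i + p) * j)) •
            (TensorAlgebra.ι k (b, (0 : A)) * TensorAlgebra.ι k ((0 : A), a)))
  | one_M : UERel k A 𝒜 br p (TensorAlgebra.ι k ((1 : A), (0 : A))) 1

/-- The universal enveloping algebra `A^{ue}` of a DG Poisson algebra `A`. -/
abbrev UEA (k : Type) [Field k] (A : Type) [Ring A] [Algebra k A]
    (𝒜 : ℤ → Submodule k A) (br : A →ₗ[k] A →ₗ[k] A) (p : ℤ) : Type :=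
  RingQuot (UERel k A 𝒜 br p)

/-- The canonical linear map `a ↦ M_a` into the universal enveloping algebra. -/
def ueM (k : Type) [Field k] (A : Type) [Ring A] [Algebra k A]
    (𝒜 : ℤ → Submodule k A) (br : A →ₗ[k] A →ₗ[k] A) (p : ℤ) :
    A →ₗ[k] UEA k A 𝒜 br p :=
  (RingQuot.mkAlgHom k (UERel k A 𝒜 br p)).toLinearMap.comp
    ((TensorAlgebra.ι k).comp (LinearMap.inl k A A))

/-- The canonical linear map `a ↦ H_a` into the universal enveloping algebra. -/
def ueH (k : Type) [Field k] (A : Type) [Ring A] [Algebra k A]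
    (𝒜 : ℤ → Submodule k A) (br : A →ₗ[k] A →ₗ[k] A) (p : ℤ) :
    A →ₗ[k] UEA k A 𝒜 br p :=
  (RingQuot.mkAlgHom k (UERel k A 𝒜 br p)).toLinearMap.comp
    ((TensorAlgebra.ι k).comp (LinearMap.inr k A A))

/-- The canonical DG-algebra structure on the universal enveloping algebra `A^{ue}`:
a grading `ℬ` for which `M_a` has degree `|a|` and `H_a` has degree `|a| + p`, and a
differential `D` with `D M_a = M_{dA a}`, `D H_a = H_{dA a}`, making `A^{ue}` a DG algebra. -/
structure IsUEADG (k : Type) [Field k] (A : Type) [Ring A] [Algebra k A]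
    (𝒜 : ℤ → Submodule k A) (dA : A →ₗ[k] A) (br : A →ₗ[k] A →ₗ[k] A) (p : ℤ)
    (ℬ : ℤ → Submodule k (UEA k A 𝒜 br p))
    (D : UEA k A 𝒜 br p →ₗ[k] UEA k A 𝒜 br p) : Prop where
  m_mem : ∀ (i : ℤ) (a : A), a ∈ 𝒜 i → ueM k A 𝒜 br p a ∈ ℬ i
  h_mem : ∀ (i : ℤ) (a : A), a ∈ 𝒜 i → ueH k A 𝒜 br p a ∈ ℬ (i + p)
  d_m : ∀ a : A, D (ueM k A 𝒜 br p a) = ueM k A 𝒜 br p (dA a)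
  d_h : ∀ a : A, D (ueH k A 𝒜 br p a) = ueH k A 𝒜 br p (dA a)
  dga : IsDGAlgebra k (UEA k A 𝒜 br p) ℬ D
/-- A DG Lie algebra structure (with Lie bracket `lb` of degree `p`) on a graded vector
space `(L, 𝒧)` with differential `dL`. -/
structure IsDGLie (k : Type) [Field k] (L : Type) [AddCommGroup L] [Module k L]
    (𝒧 : ℤ → Submodule k L) (dL : L →ₗ[k] L) (lb : L →ₗ[k] L →ₗ[k] L) (p : ℤ) : Prop where
  d_mem : ∀ (i : ℤ) (x : L), x ∈ 𝒧 i → dL x ∈ 𝒧 (i + 1)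
  d_sq : ∀ x : L, dL (dL x) = 0
  lb_mem : ∀ (i j : ℤ) (x y : L), x ∈ 𝒧 i → y ∈ 𝒧 j → lb x y ∈ 𝒧 (i + j + p)
  antisymm : ∀ (i j : ℤ) (x y : L), x ∈ 𝒧 i → y ∈ 𝒧 j →
    lb x y = -(((-1 : k) ^ ((i + p) * (j + p))) • lb y x)
  jacobi : ∀ (i j l : ℤ) (x y z : L), x ∈ 𝒧 i → y ∈ 𝒧 j → z ∈ 𝒧 l →
    lb x (lb y z) = lb (lb x y) z + ((-1 : k) ^ ((i + p) * (j + p))) • lb y (lb x z)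
  d_lb : ∀ (i j : ℤ) (x y : L), x ∈ 𝒧 i → y ∈ 𝒧 j →
    dL (lb x y) = lb (dL x) y + ((-1 : k) ^ (i + p)) • lb x (dL y)

/-- The graded-symmetry relations `x ⊗ y - (-1)^{|x||y|} y ⊗ x` defining the graded symmetric
algebra `S(L) = T(L)/(x ⊗ y - (-1)^{|x||y|} y ⊗ x)`. -/
inductive SymRel (k : Type) [Field k] (L : Type) [AddCommGroup L] [Module k L]
    (𝒧 : ℤ → Submodule k L) :
    TensorAlgebra k L → TensorAlgebra k L → Prop
  | comm : ∀ (i j : ℤ) (x y : L), x ∈ 𝒧 i → y ∈ 𝒧 j →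
      SymRel k L 𝒧 (TensorAlgebra.ι k x * TensorAlgebra.ι k y)
        (((-1 : k) ^ (i * j)) • (TensorAlgebra.ι k y * TensorAlgebra.ι k x))

/-- The graded symmetric algebra `S(L)` over the graded vector space `(L, 𝒧)`. -/
abbrev GradedSymAlg (k : Type) [Field k] (L : Type) [AddCommGroup L] [Module k L]
    (𝒧 : ℤ → Submodule k L) : Type :=
  RingQuot (SymRel k L 𝒧)

/-- The canonical linear inclusion `L → S(L)`. -/
def gsymι (k : Type) [Field k] (L : Type) [AddCommGroup L] [Module k L]
    (𝒧 : ℤ → Submodule k L) : L →ₗ[k] GradedSymAlg k L 𝒧 :=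
  (RingQuot.mkAlgHom k (SymRel k L 𝒧)).toLinearMap.comp (TensorAlgebra.ι k)

/-- The defining relations of the graded universal enveloping algebra `U(L ⋊ L)` of the
graded semidirect product `L ⋊ L` inside the tensor algebra `T(L ⋊ L)`, namely
`u ⊗ v - (-1)^{‖u‖‖v‖} v ⊗ u - [u,v]` for homogeneous `u, v ∈ L ⋊ L`.  Here a pair
`(x, a) : L × L` stands for `x + 0` in the first copy (of `U`-degree `|x|`) plus `0 + a` in
the second copy (of `U`-degree `|a| + p`); thus `(x,a)` is homogeneous of `U`-degree `m` iff
`x ∈ 𝒧 m` and `a ∈ 𝒧 (m - p)`.  The semidirect Lie bracket is zero on the first copy, the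
bracket of `L` on the second copy, and is given by the adjoint action `[0+a, y+0] = [a,y] + 0`
between the two copies, so that for homogeneous `u = (x,a)` of degree `m` and `v = (y,b)` of
degree `n` one has `[u,v] = ([a,y] - (-1)^{mn} [b,x], [a,b])`. -/
inductive SDRel (k : Type) [Field k] (L : Type) [AddCommGroup L] [Module k L]
    (𝒧 : ℤ → Submodule k L) (lb : L →ₗ[k] L →ₗ[k] L) (p : ℤ) :
    TensorAlgebra k (L × L) → TensorAlgebra k (L × L) → Prop
  | comm : ∀ (m n : ℤ) (x a y b : L),
      x ∈ 𝒧 m → a ∈ 𝒧 (m - p) → y ∈ 𝒧 n → b ∈ 𝒧 (n - p) →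
      SDRel k L 𝒧 lb p
        (TensorAlgebra.ι k ((x, a) : L × L) * TensorAlgebra.ι k ((y, b) : L × L))
        (((-1 : k) ^ (m * n)) •
            (TensorAlgebra.ι k ((y, b) : L × L) * TensorAlgebra.ι k ((x, a) : L × L)) +
          TensorAlgebra.ι k ((lb a y - ((-1 : k) ^ (m * n)) • lb b x, lb a b) : L × L))

/-- The graded universal enveloping algebra `U(L ⋊ L)` of the semidirect product DG Lie
algebra `L ⋊ L`. -/
abbrev SDUEnv (k : Type) [Field k] (L : Type) [AddCommGroup L] [Module k L]
    (𝒧 : ℤ → Submodule k L) (lb : L →ₗ[k] L →ₗ[k] L) (p : ℤ) : Type :=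
  RingQuot (SDRel k L 𝒧 lb p)

/-- The canonical linear map `L ⋊ L → U(L ⋊ L)`. -/
def sdι (k : Type) [Field k] (L : Type) [AddCommGroup L] [Module k L]
    (𝒧 : ℤ → Submodule k L) (lb : L →ₗ[k] L →ₗ[k] L) (p : ℤ) :
    (L × L) →ₗ[k] SDUEnv k L 𝒧 lb p :=
  (RingQuot.mkAlgHom k (SDRel k L 𝒧 lb p)).toLinearMap.comp (TensorAlgebra.ι k)

theorem neg_one_zpow_congr {k : Type} [Field k] {a b : ℤ} (h : Even (a - b)) :
    (-1 : k) ^ a = (-1) ^ b := by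
  rw [← sub_add_cancel a b, zpow_add₀ (neg_ne_zero.2 one_ne_zero), h.neg_one_zpow, one_mul]

section GradedInduction

variable {k A : Type} [Field k] [Ring A] [Algebra k A] (𝒜 : ℤ → Submodule k A) [GradedAlgebra 𝒜]

/-- To show that every homogeneous element of degree `i` lies in `Q i`, it suffices to check
closure under left multiplication by a family of homogeneous algebra generators. -/
theorem homogeneous_mem_of_adjoin_eq_top {G : ℤ → Set A} (hG : ∀ i, ∀ g ∈ G i, g ∈ 𝒜 i)
    (hgen : Algebra.adjoin k (⋃ i, G i) = ⊤) (Q : ℤ → Submodule k A) (one : (1 : A) ∈ Q 0)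
    (mul : ∀ i j, ∀ g ∈ G i, ∀ b ∈ 𝒜 j, b ∈ Q j → g * b ∈ Q (i + j)) {i : ℤ} {a : A}
    (ha : a ∈ 𝒜 i) : a ∈ Q i := by
  have key : ∀ t ∈ Algebra.adjoin k (⋃ i, G i), ∀ b : A,
      (∀ n, (DirectSum.decompose 𝒜 b n : A) ∈ Q n) →
      ∀ n, (DirectSum.decompose 𝒜 (t * b) n : A) ∈ Q n := by
    intro t ht
    induction ht using Algebra.adjoin_induction with
    | mem x hx =>
      obtain ⟨m, hm⟩ := Set.mem_iUnion.1 hx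
      intro b hb n
      obtain ⟨l, rfl⟩ : ∃ l, n = m + l := ⟨n - m, by ring⟩
      rw [DirectSum.coe_decompose_mul_add_of_left_mem 𝒜 (hG m x hm)]
      exact mul m l x hm _ (SetLike.coe_mem _) (hb l)
    | algebraMap r =>
      intro b hb n
      rw [Algebra.algebraMap_eq_smul_one, smul_mul_assoc, one_mul, DirectSum.decompose_smul]
      exact (Q n).smul_mem r (hb n)
    | add x y _ _ hx hy =>
      intro b hb n
      rw [add_mul, DirectSum.decompose_add]
      exact (Q n).add_mem (hx b hb n) (hy b hb n)
    | mul x y _ _ hx hy =>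
      intro b hb n
      rw [mul_assoc]
      exact hx _ (hy b hb) n
  have h1 : ∀ n, (DirectSum.decompose 𝒜 (1 : A) n : A) ∈ Q n := by
    intro n
    by_cases hn : n = 0
    · subst hn
      rwa [DirectSum.decompose_of_mem_same 𝒜 SetLike.GradedOne.one_mem]
    · rw [DirectSum.decompose_of_mem_ne 𝒜 SetLike.GradedOne.one_mem (Ne.symm hn)]
      exact (Q n).zero_mem
  have h := key a (hgen ▸ Algebra.mem_top) 1 h1 i
  rwa [mul_one, DirectSum.decompose_of_mem_same 𝒜 ha] at h

theorem linearMap_eq_of_homogeneous {B : Type} [AddCommGroup B] [Module k B] {f g : A →ₗ[k] B}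
    (h : ∀ i, ∀ a ∈ 𝒜 i, f a = g a) : f = g :=
  DirectSum.decompose_lhom_ext 𝒜 fun i => LinearMap.ext fun a => h i a a.2

/-- The linear map multiplying the component of degree `j` by `(-1) ^ (i * j)`. -/
def signTwist (i : ℤ) : A →ₗ[k] A :=
  (DirectSum.toModule k ℤ A fun j => ((-1 : k) ^ (i * j)) • (𝒜 j).subtype) ∘ₗ
    (DirectSum.decomposeLinearEquiv 𝒜).toLinearMap

theorem signTwist_apply (i : ℤ) {j : ℤ} {a : A} (ha : a ∈ 𝒜 j) :
    signTwist 𝒜 i a = ((-1 : k) ^ (i * j)) • a := by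
  lift a to 𝒜 j using ha
  simp [signTwist]

end GradedInduction

section GradedSymAlg

variable {k L : Type} [Field k] [AddCommGroup L] [Module k L] {𝒧 : ℤ → Submodule k L}

theorem adjoin_range_mkAlgHom_ι {V : Type} [AddCommGroup V] [Module k V]
    (r : TensorAlgebra k V → TensorAlgebra k V → Prop) :
    Algebra.adjoin k (Set.range fun v => RingQuot.mkAlgHom k r (TensorAlgebra.ι k v)) = ⊤ := by
  have h := congrArg (Subalgebra.map (RingQuot.mkAlgHom k r))
    (TensorAlgebra.adjoin_range_ι (R := k) (M := V))
  rw [AlgHom.map_adjoin, ← Set.range_comp, Algebra.map_top,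
    (AlgHom.range_eq_top _).2 (RingQuot.mkAlgHom_surjective k r)] at h
  exact h

theorem gsymι_mul_comm {i j : ℤ} {x y : L} (hx : x ∈ 𝒧 i) (hy : y ∈ 𝒧 j) :
    gsymι k L 𝒧 x * gsymι k L 𝒧 y =
      ((-1 : k) ^ (i * j)) • (gsymι k L 𝒧 y * gsymι k L 𝒧 x) := by
  simpa [gsymι] using RingQuot.mkAlgHom_rel k (SymRel.comm (k := k) i j x y hx hy)

/-- The universal property of the graded symmetric algebra. -/
def gsymLift {B : Type} [Ring B] [Algebra k B] (f : L →ₗ[k] B)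
    (hf : ∀ i j x y, x ∈ 𝒧 i → y ∈ 𝒧 j → f x * f y = ((-1 : k) ^ (i * j)) • (f y * f x)) :
    GradedSymAlg k L 𝒧 →ₐ[k] B :=
  RingQuot.liftAlgHom k ⟨TensorAlgebra.lift k f, by
    rintro _ _ ⟨i, j, x, y, hx, hy⟩
    simpa using hf i j x y hx hy⟩

@[simp]
theorem gsymLift_ι {B : Type} [Ring B] [Algebra k B] (f : L →ₗ[k] B)
    (hf : ∀ i j x y, x ∈ 𝒧 i → y ∈ 𝒧 j → f x * f y = ((-1 : k) ^ (i * j)) • (f y * f x)) (x : L) :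
    gsymLift f hf (gsymι k L 𝒧 x) = f x := by
  simp [gsymLift, gsymι]

theorem gsym_algHom_ext {B : Type} [Ring B] [Algebra k B] {f g : GradedSymAlg k L 𝒧 →ₐ[k] B}
    (h : ∀ x, f (gsymι k L 𝒧 x) = g (gsymι k L 𝒧 x)) : f = g :=
  RingQuot.ringQuot_ext' k _ _ (TensorAlgebra.hom_ext (LinearMap.ext h))

theorem adjoin_iUnion_gsymι [DirectSum.Decomposition 𝒧] :
    Algebra.adjoin k (⋃ i, gsymι k L 𝒧 '' (𝒧 i : Set L)) = ⊤ := by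
  rw [eq_top_iff, ← adjoin_range_mkAlgHom_ι (SymRel k L 𝒧), Algebra.adjoin_le_iff]
  rintro _ ⟨v, rfl⟩
  change gsymι k L 𝒧 v ∈ _
  induction v using DirectSum.Decomposition.inductionOn 𝒧 with
  | zero => rw [map_zero]; exact zero_mem _
  | homogeneous m =>
    exact Algebra.subset_adjoin (Set.mem_iUnion.2 ⟨_, _, m.2, rfl⟩)
  | add m m' h h' => rw [map_add]; exact add_mem h h'

variable (𝒮 : ℤ → Submodule k (GradedSymAlg k L 𝒧)) [GradedAlgebra 𝒮] [DirectSum.Decomposition 𝒧]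

theorem gsym_mem_of_homogeneous (hmem : ∀ i, ∀ x ∈ 𝒧 i, gsymι k L 𝒧 x ∈ 𝒮 i)
    (Q : ℤ → Submodule k (GradedSymAlg k L 𝒧)) (one : 1 ∈ Q 0)
    (mul : ∀ i j, ∀ x ∈ 𝒧 i, ∀ b ∈ 𝒮 j, b ∈ Q j → gsymι k L 𝒧 x * b ∈ Q (i + j))
    {i : ℤ} {a : GradedSymAlg k L 𝒧} (ha : a ∈ 𝒮 i) : a ∈ Q i :=
  homogeneous_mem_of_adjoin_eq_top 𝒮 (by rintro i _ ⟨x, hx, rfl⟩; exact hmem i x hx)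
    adjoin_iUnion_gsymι Q one (by rintro i j _ ⟨x, hx, rfl⟩; exact mul i j x hx) ha

theorem gsym_eq_of_homogeneous (hmem : ∀ i, ∀ x ∈ 𝒧 i, gsymι k L 𝒧 x ∈ 𝒮 i)
    {B : Type} [AddCommGroup B] [Module k B] (f g : ℤ → GradedSymAlg k L 𝒧 →ₗ[k] B)
    (one : f 0 1 = g 0 1)
    (mul : ∀ i j, ∀ x ∈ 𝒧 i, ∀ b ∈ 𝒮 j, f j b = g j b →
      f (i + j) (gsymι k L 𝒧 x * b) = g (i + j) (gsymι k L 𝒧 x * b))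
    {i : ℤ} {a : GradedSymAlg k L 𝒧} (ha : a ∈ 𝒮 i) : f i a = g i a :=
  gsym_mem_of_homogeneous 𝒮 hmem (fun i => LinearMap.eqLocus (f i) (g i)) one mul ha

/-- The bilinear map `(x, c) ↦ (-1) ^ (|x| |c|) M c * η x`. -/
def twistedMul {U : Type} [Ring U] [Algebra k U] (M : GradedSymAlg k L 𝒧 →ₐ[k] U) (η : L →ₗ[k] U) :
    L →ₗ[k] GradedSymAlg k L 𝒧 →ₗ[k] U :=
  (DirectSum.toModule k ℤ _ fun i =>
    ((LinearMap.mul k U).flip ∘ₗ η ∘ₗ (𝒧 i).subtype).compl₂ (M.toLinearMap ∘ₗ signTwist 𝒮 i)) ∘ₗ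
    (DirectSum.decomposeLinearEquiv 𝒧).toLinearMap

theorem twistedMul_apply {U : Type} [Ring U] [Algebra k U] (M : GradedSymAlg k L 𝒧 →ₐ[k] U)
    (η : L →ₗ[k] U) {i j : ℤ} {x : L} {c : GradedSymAlg k L 𝒧} (hx : x ∈ 𝒧 i) (hc : c ∈ 𝒮 j) :
    twistedMul 𝒮 M η x c = ((-1 : k) ^ (i * j)) • (M c * η x) := by
  lift x to 𝒧 i using hx
  simp [twistedMul, signTwist_apply 𝒮 i hc]

/-- The operator `(h, c) ↦ (M x * h + (-1) ^ (|x| |c|) M c * η x, x * c)`. -/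
def derivationStep {U : Type} [Ring U] [Algebra k U] (M : GradedSymAlg k L 𝒧 →ₐ[k] U)
    (η : L →ₗ[k] U) : L →ₗ[k] Module.End k (U × GradedSymAlg k L 𝒧) where
  toFun x := LinearMap.prod
    ((LinearMap.mulLeft k (M (gsymι k L 𝒧 x))).coprod (twistedMul 𝒮 M η x))
    (LinearMap.mulLeft k (gsymι k L 𝒧 x) ∘ₗ LinearMap.snd k _ _)
  map_add' x y := by
    ext : 1 <;> ext <;> simp [add_mul]
  map_smul' r x := by
    ext : 1 <;> ext <;> simp

theorem derivationStep_apply {U : Type} [Ring U] [Algebra k U] (M : GradedSymAlg k L 𝒧 →ₐ[k] U)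
    (η : L →ₗ[k] U) (x : L) (h : U) (c : GradedSymAlg k L 𝒧) :
    derivationStep 𝒮 M η x (h, c) =
      (M (gsymι k L 𝒧 x) * h + twistedMul 𝒮 M η x c, gsymι k L 𝒧 x * c) := rfl

theorem derivationStep_mul_comm {U : Type} [Ring U] [Algebra k U]
    (hmem : ∀ i, ∀ x ∈ 𝒧 i, gsymι k L 𝒧 x ∈ 𝒮 i) (M : GradedSymAlg k L 𝒧 →ₐ[k] U)
    (η : L →ₗ[k] U) (i j : ℤ) (x y : L) (hx : x ∈ 𝒧 i) (hy : y ∈ 𝒧 j) :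
    derivationStep 𝒮 M η x * derivationStep 𝒮 M η y =
      ((-1 : k) ^ (i * j)) • (derivationStep 𝒮 M η y * derivationStep 𝒮 M η x) := by
  have hxy := gsymι_mul_comm hx hy
  refine LinearMap.prod_ext ?_ ?_
  · ext h
    · simp [derivationStep_apply, ← mul_assoc, ← map_mul, hxy]
    · simp [derivationStep_apply]
  · refine linearMap_eq_of_homogeneous 𝒮 fun l c hc => ?_
    have hxc := SetLike.GradedMul.mul_mem (hmem i x hx) hc
    have hyc := SetLike.GradedMul.mul_mem (hmem j y hy) hc
    simp only [LinearMap.comp_apply, LinearMap.inr_apply, Module.End.mul_apply,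
      LinearMap.smul_apply, derivationStep_apply, mul_zero, zero_add,
      twistedMul_apply 𝒮 M η hx hc, twistedMul_apply 𝒮 M η hy hc,
      twistedMul_apply 𝒮 M η hx hyc, twistedMul_apply 𝒮 M η hy hxc, Prod.smul_mk, Prod.mk.injEq]
    constructor
    · simp only [map_mul, mul_smul_comm, smul_add, smul_smul, mul_assoc,
        ← zpow_add₀ (neg_ne_zero.2 (one_ne_zero (α := k)))]
      rw [add_comm]
      congr 2 <;> apply neg_one_zpow_congr <;>
        simp only [Int.even_add, Int.even_sub, Int.even_mul] <;> tauto
    · rw [← mul_assoc, hxy, smul_mul_assoc, mul_assoc]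

/-- A linear map out of the generators extends to a graded derivation of `S(L)` with values in a
left `S(L)`-module algebra, with the Koszul-twisted right action. -/
theorem exists_gsym_derivation {U : Type} [Ring U] [Algebra k U]
    (hmem : ∀ i, ∀ x ∈ 𝒧 i, gsymι k L 𝒧 x ∈ 𝒮 i)
    (hcomm : ∀ i j, ∀ a ∈ 𝒮 i, ∀ b ∈ 𝒮 j, a * b = ((-1 : k) ^ (i * j)) • (b * a))
    (M : GradedSymAlg k L 𝒧 →ₐ[k] U) (η : L →ₗ[k] U) :
    ∃ H : GradedSymAlg k L 𝒧 →ₗ[k] U, (∀ x, H (gsymι k L 𝒧 x) = η x) ∧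
      ∀ i j, ∀ a ∈ 𝒮 i, ∀ b ∈ 𝒮 j,
        H (a * b) = M a * H b + ((-1 : k) ^ (i * j)) • (M b * H a) := by
  obtain ⟨ρ, hρ⟩ : ∃ ρ : GradedSymAlg k L 𝒧 →ₐ[k] Module.End k (U × GradedSymAlg k L 𝒧),
      ∀ x v, ρ (gsymι k L 𝒧 x) v = derivationStep 𝒮 M η x v :=
    ⟨gsymLift (B := Module.End k (U × GradedSymAlg k L 𝒧)) (derivationStep 𝒮 M η)
      (derivationStep_mul_comm 𝒮 hmem M η), fun x v => by rw [gsymLift_ι]⟩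
  obtain ⟨ev, hev⟩ : ∃ ev : U × GradedSymAlg k L 𝒧 →
      GradedSymAlg k L 𝒧 →ₗ[k] U × GradedSymAlg k L 𝒧, ∀ v a, ev v a = ρ a v :=
    ⟨fun v => LinearMap.applyₗ v ∘ₗ ρ.toLinearMap, fun _ _ => rfl⟩
  obtain ⟨H, hH⟩ : ∃ H : GradedSymAlg k L 𝒧 →ₗ[k] U, ∀ a, H a = (ρ a (0, 1)).1 :=
    ⟨LinearMap.fst k _ _ ∘ₗ ev (0, 1), fun a => by rw [LinearMap.comp_apply, hev]; rfl⟩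
  have hH1 : H 1 = 0 := by rw [hH, map_one]; rfl
  have hsnd : ∀ i, ∀ a ∈ 𝒮 i, ρ a (0, 1) = (H a, a) := fun i a ha => by
    rw [← hev]
    refine gsym_eq_of_homogeneous 𝒮 hmem (fun _ => ev (0, 1)) (fun _ => H.prod LinearMap.id)
      (by rw [hev, map_one, LinearMap.prod_apply, Function.prod, hH1]; rfl)
      (fun i j x hx b hb hb' => ?_) ha
    replace hb' : ρ b (0, 1) = (H b, b) := by rw [← hev]; exact hb'
    rw [hev, LinearMap.prod_apply, Function.prod, hH, map_mul, Module.End.mul_apply, hb', hρ,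
      derivationStep_apply]
    rfl
  have hHx (x : L) {j : ℤ} {b} (hb : b ∈ 𝒮 j) :
      H (gsymι k L 𝒧 x * b) = M (gsymι k L 𝒧 x) * H b + twistedMul 𝒮 M η x b := by
    rw [hH, map_mul, Module.End.mul_apply, hsnd j b hb, hρ, derivationStep_apply]
  have hmain (h : U) {l : ℤ} {c} (hc : c ∈ 𝒮 l) {i : ℤ} {a} (ha : a ∈ 𝒮 i) :
      ρ a (h, c) = (M a * h + ((-1 : k) ^ (i * l)) • (M c * H a), a * c) := by
    rw [← hev]
    refine gsym_eq_of_homogeneous 𝒮 hmem (fun _ => ev (h, c))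
      (fun i => (LinearMap.mulRight k h ∘ₗ M.toLinearMap +
        ((-1 : k) ^ (i * l)) • (LinearMap.mulLeft k (M c) ∘ₗ H)).prod
          (LinearMap.mulRight k c)) ?_ (fun i j x hx b hb hb' => ?_) ha
    · simp [hev, hH1]
    replace hb' : ρ b (h, c) = (M b * h + ((-1 : k) ^ (j * l)) • (M c * H b), b * c) := by
      rw [← hev]; exact hb'
    rw [hev]
    change _ = (M (gsymι k L 𝒧 x * b) * h +
      ((-1 : k) ^ ((i + j) * l)) • (M c * H (gsymι k L 𝒧 x * b)), gsymι k L 𝒧 x * b * c)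
    have hM {i a} (ha : a ∈ 𝒮 i) (z : U) :
        M a * (M c * z) = ((-1 : k) ^ (i * l)) • (M c * (M a * z)) := by
      rw [← mul_assoc, ← map_mul, hcomm i l a ha c hc, map_smul, map_mul, smul_mul_assoc,
        mul_assoc]
    have hbc := SetLike.GradedMul.mul_mem hb hc
    simp only [map_mul, Module.End.mul_apply, hb', hρ, derivationStep_apply,
      twistedMul_apply 𝒮 M η hx hbc, hHx x hb, twistedMul_apply 𝒮 M η hx hb, mul_assoc,
      Prod.mk.injEq, and_true]
    simp only [mul_add, mul_smul_comm, hM (hmem i x hx), hM hb, smul_add, smul_smul, add_assoc,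
      ← zpow_add₀ (neg_ne_zero.2 (one_ne_zero (α := k)))]
    congr 3 <;> apply neg_one_zpow_congr <;>
      simp only [Int.even_add, Int.even_sub, Int.even_mul] <;> tauto
  refine ⟨H, fun x => ?_, fun i j a ha b hb => ?_⟩
  · have h1 : (1 : GradedSymAlg k L 𝒧) ∈ 𝒮 0 := SetLike.GradedOne.one_mem
    rw [← mul_one (gsymι k L 𝒧 x), hHx x h1, hH1]
    induction x using DirectSum.Decomposition.inductionOn 𝒧 with
    | zero => simp
    | homogeneous m => simp [twistedMul_apply 𝒮 M η m.2 h1]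
    | add m m' h h' => simp_all
  · rw [hH, map_mul, Module.End.mul_apply, hsnd j b hb, hmain _ hb ha]

end GradedSymAlg

section PoissonRelations

variable {k A U : Type} [Field k] [Ring A] [Algebra k A] [Ring U] [Algebra k U]
  {𝒜 : ℤ → Submodule k A} {br : A →ₗ[k] A →ₗ[k] A} {p : ℤ} {M : A →ₐ[k] U} {H : A →ₗ[k] U}
  {i j l : ℤ} {a b c : A}

theorem map_br_mul_right
    (hpoisson : br a (b * c) = br a b * c + ((-1 : k) ^ ((i + p) * j)) • (b * br a c))
    (hab : M (br a b) = H a * M b - ((-1 : k) ^ ((i + p) * j)) • (M b * H a))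
    (hac : M (br a c) = H a * M c - ((-1 : k) ^ ((i + p) * l)) • (M c * H a)) :
    M (br a (b * c)) = H a * M (b * c) - ((-1 : k) ^ ((i + p) * (j + l))) • (M (b * c) * H a) := by
  rw [hpoisson, mul_add, zpow_add₀ (neg_ne_zero.2 one_ne_zero)]
  simp only [map_add, map_smul, map_mul, hab, hac, sub_mul, mul_sub, smul_mul_assoc,
    mul_smul_comm, mul_assoc]
  module

theorem map_br_mul_left
    (hac' : a * c = ((-1 : k) ^ (i * l)) • (c * a)) (hbc' : b * c = ((-1 : k) ^ (j * l)) • (c * b))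
    (hH : H (a * b) = M a * H b + ((-1 : k) ^ (i * j)) • (M b * H a))
    (hbider : br (a * b) c = a * br b c + ((-1 : k) ^ (i * j)) • (b * br a c))
    (hac : M (br a c) = H a * M c - ((-1 : k) ^ ((i + p) * l)) • (M c * H a))
    (hbc : M (br b c) = H b * M c - ((-1 : k) ^ ((j + p) * l)) • (M c * H b)) :
    M (br (a * b) c) =
      H (a * b) * M c - ((-1 : k) ^ ((i + j + p) * l)) • (M c * H (a * b)) := by
  have hMac (z : U) : M a * (M c * z) = ((-1 : k) ^ (i * l)) • (M c * (M a * z)) := by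
    rw [← mul_assoc, ← map_mul, hac', map_smul, map_mul, smul_mul_assoc, mul_assoc]
  have hMbc (z : U) : M b * (M c * z) = ((-1 : k) ^ (j * l)) • (M c * (M b * z)) := by
    rw [← mul_assoc, ← map_mul, hbc', map_smul, map_mul, smul_mul_assoc, mul_assoc]
  simp only [hbider, hH, map_add, map_smul, map_mul, hac, hbc, mul_sub, add_mul, mul_add,
    smul_mul_assoc, mul_smul_comm, mul_assoc, hMac, hMbc,
    zpow_add₀ (neg_ne_zero.2 (one_ne_zero (α := k)))]
  module

theorem hamiltonian_br_mul_right
    (hH : ∀ i j, ∀ a ∈ 𝒜 i, ∀ b ∈ 𝒜 j,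
      H (a * b) = M a * H b + ((-1 : k) ^ (i * j)) • (M b * H a))
    (hb' : b ∈ 𝒜 j) (hc' : c ∈ 𝒜 l)
    (hab' : br a b ∈ 𝒜 (i + j + p)) (hac' : br a c ∈ 𝒜 (i + l + p))
    (hpoisson : br a (b * c) = br a b * c + ((-1 : k) ^ ((i + p) * j)) • (b * br a c))
    (hMab : M (br a b) = H a * M b - ((-1 : k) ^ ((i + p) * j)) • (M b * H a))
    (hMac : M (br a c) = H a * M c - ((-1 : k) ^ ((i + p) * l)) • (M c * H a))
    (hab : H (br a b) = H a * H b - ((-1 : k) ^ ((i + p) * (j + p))) • (H b * H a))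
    (hac : H (br a c) = H a * H c - ((-1 : k) ^ ((i + p) * (l + p))) • (H c * H a)) :
    H (br a (b * c)) =
      H a * H (b * c) - ((-1 : k) ^ ((i + p) * (j + l + p))) • (H (b * c) * H a) := by
  have hsq : (-1 : k) ^ ((i + p) * j) * (-1 : k) ^ (j * (i + l + p)) = (-1 : k) ^ (j * l) := by
    rw [← zpow_add₀ (neg_ne_zero.2 one_ne_zero)]
    apply neg_one_zpow_congr
    simp only [Int.even_add, Int.even_sub, Int.even_mul]
    tauto
  simp only [hpoisson, map_add, map_smul, hH _ _ _ hab' _ hc', hH _ _ _ hb' _ hac',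
    hH _ _ _ hb' _ hc', smul_add, smul_smul, hsq]
  simp only [hMab, hMac, hab, hac, sub_mul, mul_sub, add_mul, mul_add, smul_add, smul_sub,
    smul_mul_assoc, mul_smul_comm, mul_assoc, zpow_add₀ (neg_ne_zero.2 (one_ne_zero (α := k)))]
  module

theorem hamiltonian_br_symm
    (hanti : br b a = -(((-1 : k) ^ ((j + p) * (i + p))) • br a b))
    (hab : H (br a b) = H a * H b - ((-1 : k) ^ ((i + p) * (j + p))) • (H b * H a)) :
    H (br b a) = H b * H a - ((-1 : k) ^ ((j + p) * (i + p))) • (H a * H b) := by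
  have hsq : (-1 : k) ^ ((j + p) * (i + p)) * (-1 : k) ^ ((i + p) * (j + p)) = 1 := by
    rw [mul_comm (i + p), ← zpow_add₀ (neg_ne_zero.2 one_ne_zero), Even.neg_one_zpow ⟨_, rfl⟩]
  rw [hanti, map_neg, map_smul, hab, smul_sub, smul_smul, hsq, one_smul, neg_sub]

theorem hamiltonian_differential_mul {d : A →ₗ[k] A} {ℬ : ℤ → Submodule k U} {D : U →ₗ[k] U}
    (hH : ∀ i j, ∀ a ∈ 𝒜 i, ∀ b ∈ 𝒜 j,
      H (a * b) = M a * H b + ((-1 : k) ^ (i * j)) • (M b * H a))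
    (hD : ∀ (i j : ℤ) (x y : U), x ∈ ℬ i → y ∈ ℬ j →
      D (x * y) = D x * y + ((-1 : k) ^ i) • (x * D y))
    (hd : d (a * b) = d a * b + ((-1 : k) ^ i) • (a * d b))
    (ha : a ∈ 𝒜 i) (hb : b ∈ 𝒜 j) (hda : d a ∈ 𝒜 (i + 1)) (hdb : d b ∈ 𝒜 (j + 1))
    (hMa : M a ∈ ℬ i) (hMb : M b ∈ ℬ j) (hHa : H a ∈ ℬ (i + p)) (hHb : H b ∈ ℬ (j + p))
    (hMda : M (d a) = D (M a)) (hMdb : M (d b) = D (M b))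
    (hHda : H (d a) = D (H a)) (hHdb : H (d b) = D (H b)) :
    H (d (a * b)) = D (H (a * b)) := by
  have hsq : (-1 : k) ^ i * (-1 : k) ^ (i * (j + 1)) = (-1 : k) ^ (i * j) := by
    rw [← zpow_add₀ (neg_ne_zero.2 one_ne_zero)]
    apply neg_one_zpow_congr
    simp only [Int.even_add, Int.even_sub, Int.even_mul, Int.not_even_one]
    tauto
  simp only [hd, map_add, map_smul, hH _ _ _ hda _ hb, hH _ _ _ ha _ hdb, hH _ _ _ ha _ hb,
    hD _ _ _ _ hMa hHb, hD _ _ _ _ hMb hHa, hMda, hMdb, hHda, hHdb, smul_add, smul_smul, hsq,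
    add_mul, one_mul, zpow_add₀ (neg_ne_zero.2 (one_ne_zero (α := k)))]
  module

end PoissonRelations

section UniversalProperties

variable {k A : Type} [Field k] [Ring A] [Algebra k A] {𝒜 : ℤ → Submodule k A}
  {br : A →ₗ[k] A →ₗ[k] A} {p : ℤ}

theorem ueM_mul [GradedAlgebra 𝒜] (a b : A) :
    ueM k A 𝒜 br p (a * b) = ueM k A 𝒜 br p a * ueM k A 𝒜 br p b := by
  have h : (LinearMap.mul k A).compr₂ (ueM k A 𝒜 br p) =
      (LinearMap.mul k _).compl₁₂ (ueM k A 𝒜 br p) (ueM k A 𝒜 br p) :=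
    linearMap_eq_of_homogeneous 𝒜 fun i a ha => linearMap_eq_of_homogeneous 𝒜 fun j b hb => by
      simpa [ueM] using RingQuot.mkAlgHom_rel k (UERel.mul_M (br := br) (p := p) i j a b ha hb)
  exact LinearMap.congr_fun₂ h a b

theorem ueM_one : ueM k A 𝒜 br p 1 = 1 := by
  simpa [ueM] using RingQuot.mkAlgHom_rel k (UERel.one_M (𝒜 := 𝒜) (br := br) (p := p))

/-- The map `a ↦ M_a` as an algebra homomorphism. -/
def ueMHom [GradedAlgebra 𝒜] : A →ₐ[k] UEA k A 𝒜 br p :=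
  AlgHom.ofLinearMap (ueM k A 𝒜 br p) ueM_one ueM_mul

theorem ueH_br {i j : ℤ} {a b : A} (ha : a ∈ 𝒜 i) (hb : b ∈ 𝒜 j) :
    ueH k A 𝒜 br p (br a b) = ueH k A 𝒜 br p a * ueH k A 𝒜 br p b -
      ((-1 : k) ^ ((i + p) * (j + p))) • (ueH k A 𝒜 br p b * ueH k A 𝒜 br p a) := by
  simpa [ueH] using RingQuot.mkAlgHom_rel k (UERel.br_H (br := br) (p := p) i j a b ha hb)

theorem ueH_mul {i j : ℤ} {a b : A} (ha : a ∈ 𝒜 i) (hb : b ∈ 𝒜 j) :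
    ueH k A 𝒜 br p (a * b) = ueM k A 𝒜 br p a * ueH k A 𝒜 br p b +
      ((-1 : k) ^ (i * j)) • (ueM k A 𝒜 br p b * ueH k A 𝒜 br p a) := by
  simpa [ueH, ueM] using RingQuot.mkAlgHom_rel k (UERel.mul_H (br := br) (p := p) i j a b ha hb)

theorem ueM_br {i j : ℤ} {a b : A} (ha : a ∈ 𝒜 i) (hb : b ∈ 𝒜 j) :
    ueM k A 𝒜 br p (br a b) = ueH k A 𝒜 br p a * ueM k A 𝒜 br p b -
      ((-1 : k) ^ ((i + p) * j)) • (ueM k A 𝒜 br p b * ueH k A 𝒜 br p a) := by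
  simpa [ueH, ueM] using RingQuot.mkAlgHom_rel k (UERel.br_M (br := br) (p := p) i j a b ha hb)

theorem ueH_one [GradedAlgebra 𝒜] : ueH k A 𝒜 br p 1 = 0 := by
  have h1 : (1 : A) ∈ 𝒜 0 := SetLike.GradedOne.one_mem
  simpa [ueM_one] using ueH_mul (br := br) (p := p) h1 h1

/-- The universal property of the universal enveloping algebra of a DG Poisson algebra. -/
theorem exists_ueLift {B : Type} [Ring B] [Algebra k B] (M : A →ₐ[k] B) (H : A →ₗ[k] B)
    (br_H : ∀ i j, ∀ a ∈ 𝒜 i, ∀ b ∈ 𝒜 j,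
      H (br a b) = H a * H b - ((-1 : k) ^ ((i + p) * (j + p))) • (H b * H a))
    (mul_H : ∀ i j, ∀ a ∈ 𝒜 i, ∀ b ∈ 𝒜 j,
      H (a * b) = M a * H b + ((-1 : k) ^ (i * j)) • (M b * H a))
    (br_M : ∀ i j, ∀ a ∈ 𝒜 i, ∀ b ∈ 𝒜 j,
      M (br a b) = H a * M b - ((-1 : k) ^ ((i + p) * j)) • (M b * H a)) :
    ∃ Φ : UEA k A 𝒜 br p →ₐ[k] B,
      (∀ a, Φ (ueM k A 𝒜 br p a) = M a) ∧ ∀ a, Φ (ueH k A 𝒜 br p a) = H a := by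
  have hrel : ∀ ⦃s t⦄, UERel k A 𝒜 br p s t →
      TensorAlgebra.lift k (M.toLinearMap.coprod H) s =
        TensorAlgebra.lift k (M.toLinearMap.coprod H) t := by
    intro _ _ h
    cases h with
    | mul_M i j a b ha hb => simp
    | br_H i j a b ha hb => simpa using br_H i j a ha b hb
    | mul_H i j a b ha hb => simpa using mul_H i j a ha b hb
    | br_M i j a b ha hb => simpa using br_M i j a ha b hb
    | one_M => simp
  exact ⟨RingQuot.liftAlgHom k ⟨_, hrel⟩, fun a => by simp [ueM], fun a => by simp [ueH]⟩

theorem ue_algHom_ext {B : Type} [Ring B] [Algebra k B] {f g : UEA k A 𝒜 br p →ₐ[k] B}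
    (hM : ∀ a, f (ueM k A 𝒜 br p a) = g (ueM k A 𝒜 br p a))
    (hH : ∀ a, f (ueH k A 𝒜 br p a) = g (ueH k A 𝒜 br p a)) : f = g :=
  RingQuot.ringQuot_ext' k _ _ (TensorAlgebra.hom_ext
    (LinearMap.prod_ext (LinearMap.ext hM) (LinearMap.ext hH)))

theorem adjoin_ue [GradedAlgebra 𝒜] :
    Algebra.adjoin k (⋃ i, (ueM k A 𝒜 br p '' (𝒜 i : Set A) ∪
      ueH k A 𝒜 br p '' (𝒜 (i - p) : Set A))) = ⊤ := by
  rw [eq_top_iff, ← adjoin_range_mkAlgHom_ι (UERel k A 𝒜 br p), Algebra.adjoin_le_iff]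
  rintro _ ⟨⟨v, w⟩, rfl⟩
  have h : RingQuot.mkAlgHom k (UERel k A 𝒜 br p) (TensorAlgebra.ι k (v, w)) =
      ueM k A 𝒜 br p v + ueH k A 𝒜 br p w := by
    simp [ueM, ueH, ← map_add]
  change RingQuot.mkAlgHom k (UERel k A 𝒜 br p) (TensorAlgebra.ι k (v, w)) ∈ _
  rw [h]
  clear h
  refine add_mem ?_ ?_
  · induction v using DirectSum.Decomposition.inductionOn 𝒜 with
    | zero => rw [map_zero]; exact zero_mem _
    | homogeneous m =>
      exact Algebra.subset_adjoin (Set.mem_iUnion.2 ⟨_, Or.inl ⟨_, m.2, rfl⟩⟩)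
    | add m m' h h' => rw [map_add]; exact add_mem h h'
  · induction w using DirectSum.Decomposition.inductionOn 𝒜 with
    | zero => rw [map_zero]; exact zero_mem _
    | @homogeneous i m =>
      exact Algebra.subset_adjoin (Set.mem_iUnion.2
        ⟨i + p, Or.inr ⟨_, by rw [add_sub_cancel_right]; exact m.2, rfl⟩⟩)
    | add m m' h h' => rw [map_add]; exact add_mem h h'

variable {L : Type} [AddCommGroup L] [Module k L] {𝒧 : ℤ → Submodule k L} {lb : L →ₗ[k] L →ₗ[k] L}

theorem sdι_mul {m n : ℤ} {x a y b : L} (hx : x ∈ 𝒧 m) (ha : a ∈ 𝒧 (m - p)) (hy : y ∈ 𝒧 n)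
    (hb : b ∈ 𝒧 (n - p)) :
    sdι k L 𝒧 lb p (x, a) * sdι k L 𝒧 lb p (y, b) =
      ((-1 : k) ^ (m * n)) • (sdι k L 𝒧 lb p (y, b) * sdι k L 𝒧 lb p (x, a)) +
        sdι k L 𝒧 lb p (lb a y - ((-1 : k) ^ (m * n)) • lb b x, lb a b) := by
  simpa only [sdι, map_mul, map_add, map_smul, LinearMap.comp_apply, AlgHom.toLinearMap_apply]
    using RingQuot.mkAlgHom_rel k (SDRel.comm (k := k) (lb := lb) m n x a y b hx ha hy hb)

/-- The universal property of the enveloping algebra of the semidirect product `L ⋊ L`, in terms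
of the restrictions of a linear map to the two copies of `L`. -/
theorem exists_sdLift {B : Type} [Ring B] [Algebra k B]
    (μ η : L →ₗ[k] B)
    (hμ : ∀ i j, ∀ x ∈ 𝒧 i, ∀ y ∈ 𝒧 j, μ x * μ y = ((-1 : k) ^ (i * j)) • (μ y * μ x))
    (hη : ∀ i j, ∀ a ∈ 𝒧 i, ∀ b ∈ 𝒧 j,
      η (lb a b) = η a * η b - ((-1 : k) ^ ((i + p) * (j + p))) • (η b * η a))
    (hημ : ∀ i j, ∀ a ∈ 𝒧 i, ∀ y ∈ 𝒧 j,
      μ (lb a y) = η a * μ y - ((-1 : k) ^ ((i + p) * j)) • (μ y * η a)) :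
    ∃ Ψ : SDUEnv k L 𝒧 lb p →ₐ[k] B, ∀ x a, Ψ (sdι k L 𝒧 lb p (x, a)) = μ x + η a := by
  have hrel : ∀ ⦃s t⦄, SDRel k L 𝒧 lb p s t →
      TensorAlgebra.lift k (μ.coprod η) s = TensorAlgebra.lift k (μ.coprod η) t := by
    rintro _ _ ⟨m, n, x, a, y, b, hx, ha, hy, hb⟩
    have h1 := hμ m n x hx y hy
    have h2 := hη _ _ a ha b hb
    have h3 := hημ _ _ a ha y hy
    have h4 := hημ _ _ b hb x hx
    have hsq : (-1 : k) ^ (m * n) * (-1 : k) ^ (n * m) = 1 := by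
      rw [mul_comm n, ← zpow_add₀ (neg_ne_zero.2 one_ne_zero), Even.neg_one_zpow ⟨_, rfl⟩]
    simp only [sub_add_cancel] at h2 h3 h4
    simp only [map_mul, map_add, map_smul, TensorAlgebra.lift_ι_apply, LinearMap.coprod_apply,
      map_sub, h2, h3, h4, add_mul, mul_add, h1, smul_sub, smul_smul, hsq]
    module
  exact ⟨RingQuot.liftAlgHom k ⟨_, hrel⟩, fun x a => by simp [sdι]⟩

theorem sd_algHom_ext {B : Type} [Ring B] [Algebra k B] {f g : SDUEnv k L 𝒧 lb p →ₐ[k] B}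
    (hM : ∀ x, f (sdι k L 𝒧 lb p (x, 0)) = g (sdι k L 𝒧 lb p (x, 0)))
    (hH : ∀ a, f (sdι k L 𝒧 lb p (0, a)) = g (sdι k L 𝒧 lb p (0, a))) : f = g :=
  RingQuot.ringQuot_ext' k _ _ (TensorAlgebra.hom_ext
    (LinearMap.prod_ext (LinearMap.ext hM) (LinearMap.ext hH)))

end UniversalProperties

section DGAlgebra

variable {k A B : Type} [Field k] [Ring A] [Algebra k A] [Ring B] [Algebra k B]
  {𝒜 : ℤ → Submodule k A} {dA : A →ₗ[k] A} {ℬ : ℤ → Submodule k B} {dB : B →ₗ[k] B}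

theorem IsDGAlgebra.d_one (hA : IsDGAlgebra k A 𝒜 dA) : dA 1 = 0 := by
  have h1 : (1 : A) ∈ 𝒜 0 := hA.graded_monoid.one_mem
  simpa using hA.d_mul 0 0 1 1 h1 h1

/-- An algebra homomorphism between DG algebras is a morphism of DG algebras as soon as it respects
degrees and differentials on homogeneous algebra generators. -/
theorem IsDGAlgebra.algHom_of_adjoin_eq_top (hA : IsDGAlgebra k A 𝒜 dA)
    (hB : IsDGAlgebra k B ℬ dB) (Φ : A →ₐ[k] B) {G : ℤ → Set A} (hG : ∀ i, ∀ g ∈ G i, g ∈ 𝒜 i)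
    (hgen : Algebra.adjoin k (⋃ i, G i) = ⊤) (hmem : ∀ i, ∀ g ∈ G i, Φ g ∈ ℬ i)
    (hd : ∀ i, ∀ g ∈ G i, Φ (dA g) = dB (Φ g)) :
    (∀ i, ∀ a ∈ 𝒜 i, Φ a ∈ ℬ i) ∧ ∀ a, Φ (dA a) = dB (Φ a) := by
  let _ : GradedAlgebra 𝒜 :=
    { hA.graded_monoid with toDecomposition := hA.decomp.some }
  have key : ∀ i, ∀ a ∈ 𝒜 i, Φ a ∈ ℬ i ∧ Φ (dA a) = dB (Φ a) := fun i a ha =>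
    homogeneous_mem_of_adjoin_eq_top 𝒜 hG hgen
      (fun i => (ℬ i).comap Φ.toLinearMap ⊓
        LinearMap.eqLocus (Φ.toLinearMap ∘ₗ dA) (dB ∘ₗ Φ.toLinearMap))
      ⟨by simpa using hB.graded_monoid.one_mem, by simp [hA.d_one, hB.d_one]⟩
      (fun i j g hg b hb hb' => by
        obtain ⟨h1, h2⟩ := hb'
        replace h1 : Φ b ∈ ℬ j := h1
        replace h2 : Φ (dA b) = dB (Φ b) := h2
        refine ⟨?_, ?_⟩
        · simpa using hB.graded_monoid.mul_mem (hmem i g hg) h1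
        · simp [hA.d_mul i j g b (hG i g hg) hb, hB.d_mul i j _ _ (hmem i g hg) h1, h2,
            hd i g hg]) ha
  exact ⟨fun i a ha => (key i a ha).1, fun a => LinearMap.congr_fun
    (linearMap_eq_of_homogeneous 𝒜 (f := Φ.toLinearMap ∘ₗ dA) (g := dB ∘ₗ Φ.toLinearMap)
      fun i a ha => (key i a ha).2) a⟩

/-- An algebra homomorphism out of the universal enveloping algebra is a morphism of DG algebras as
soon as it respects degrees and differentials on the generators `M_a` and `H_a`. -/
theorem IsUEADG.algHom_of_generators {br : A →ₗ[k] A →ₗ[k] A} {p : ℤ} [GradedAlgebra 𝒜]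
    {ℬA : ℤ → Submodule k (UEA k A 𝒜 br p)} {DA : UEA k A 𝒜 br p →ₗ[k] UEA k A 𝒜 br p}
    (hA : IsUEADG k A 𝒜 dA br p ℬA DA) (hB : IsDGAlgebra k B ℬ dB)
    (Φ : UEA k A 𝒜 br p →ₐ[k] B)
    (hMmem : ∀ i, ∀ a ∈ 𝒜 i, Φ (ueM k A 𝒜 br p a) ∈ ℬ i)
    (hHmem : ∀ i, ∀ a ∈ 𝒜 i, Φ (ueH k A 𝒜 br p a) ∈ ℬ (i + p))
    (hMd : ∀ a, Φ (ueM k A 𝒜 br p (dA a)) = dB (Φ (ueM k A 𝒜 br p a)))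
    (hHd : ∀ a, Φ (ueH k A 𝒜 br p (dA a)) = dB (Φ (ueH k A 𝒜 br p a))) :
    (∀ i, ∀ x ∈ ℬA i, Φ x ∈ ℬ i) ∧ ∀ x, Φ (DA x) = dB (Φ x) := by
  refine hA.dga.algHom_of_adjoin_eq_top hB Φ
    (G := fun i => ueM k A 𝒜 br p '' (𝒜 i : Set A) ∪ ueH k A 𝒜 br p '' (𝒜 (i - p) : Set A))
    ?_ adjoin_ue ?_ ?_
  · rintro i _ (⟨a, ha, rfl⟩ | ⟨a, ha, rfl⟩)
    · exact hA.m_mem i a ha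
    · simpa using hA.h_mem _ a ha
  · rintro i _ (⟨a, ha, rfl⟩ | ⟨a, ha, rfl⟩)
    · exact hMmem i a ha
    · simpa using hHmem _ a ha
  · rintro i _ (⟨a, ha, rfl⟩ | ⟨a, ha, rfl⟩)
    · rw [hA.d_m, hMd]
    · rw [hA.d_h, hHd]

end DGAlgebra

/-- Let `(L, dL, [-,-])` be a DG Lie algebra with bracket of degree `p`
and `S(L)` the associated DG Poisson algebra (grading `𝒮`, differential `dS`, bracket `brS`
of degree `p`).  Then there is an isomorphism of DG algebras
`Φ : S(L)^{ue} → U(L ⋊ L)` with `Φ(M_a) = a + 0` and `Φ(H_a) = 0 + a` for all `a ∈ L`. -/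
theorem symAlg_ue_iso_semidirect_env
    (k : Type) [Field k] (L : Type) [AddCommGroup L] [Module k L]
    (𝒧 : ℤ → Submodule k L) [DirectSum.Decomposition 𝒧]
    (dL : L →ₗ[k] L) (lb : L →ₗ[k] L →ₗ[k] L) (p : ℤ)
    (hL : IsDGLie k L 𝒧 dL lb p)
    -- the DG Poisson structure on `S(L)` from Statement 14
    (𝒮 : ℤ → Submodule k (GradedSymAlg k L 𝒧)) [GradedAlgebra 𝒮]
    (dS : GradedSymAlg k L 𝒧 →ₗ[k] GradedSymAlg k L 𝒧)
    (brS : GradedSymAlg k L 𝒧 →ₗ[k] GradedSymAlg k L 𝒧 →ₗ[k] GradedSymAlg k L 𝒧)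
    (hmem : ∀ (i : ℤ) (x : L), x ∈ 𝒧 i → gsymι k L 𝒧 x ∈ 𝒮 i)
    (hdS : ∀ x : L, dS (gsymι k L 𝒧 x) = gsymι k L 𝒧 (dL x))
    (hbrS : ∀ x y : L, brS (gsymι k L 𝒧 x) (gsymι k L 𝒧 y) = gsymι k L 𝒧 (lb x y))
    (hbider₁ : ∀ (i j l : ℤ) (u v w : GradedSymAlg k L 𝒧), u ∈ 𝒮 i → v ∈ 𝒮 j → w ∈ 𝒮 l →
      brS u (v * w) = brS u v * w + ((-1 : k) ^ ((i + p) * j)) • (v * brS u w))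
    (hbider₂ : ∀ (i j l : ℤ) (u v w : GradedSymAlg k L 𝒧), u ∈ 𝒮 i → v ∈ 𝒮 j → w ∈ 𝒮 l →
      brS (u * v) w = u * brS v w + ((-1 : k) ^ (i * j)) • (v * brS u w))
    (hS : IsDGPoissonAlgebra k (GradedSymAlg k L 𝒧) 𝒮 dS brS p)
    -- the canonical DG-algebra structure on `S(L)^{ue}`
    (ℬS : ℤ → Submodule k (UEA k (GradedSymAlg k L 𝒧) 𝒮 brS p))
    (DS : UEA k (GradedSymAlg k L 𝒧) 𝒮 brS p →ₗ[k] UEA k (GradedSymAlg k L 𝒧) 𝒮 brS p)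
    (hueS : IsUEADG k (GradedSymAlg k L 𝒧) 𝒮 dS brS p ℬS DS)
    -- the DG-algebra structure on `U(L ⋊ L)`
    (ℬU : ℤ → Submodule k (SDUEnv k L 𝒧 lb p))
    (DU : SDUEnv k L 𝒧 lb p →ₗ[k] SDUEnv k L 𝒧 lb p)
    (hBU : ∀ (m : ℤ) (x a : L), x ∈ 𝒧 m → a ∈ 𝒧 (m - p) →
      sdι k L 𝒧 lb p (x, a) ∈ ℬU m)
    (hDU : ∀ u : L × L, DU (sdι k L 𝒧 lb p u) = sdι k L 𝒧 lb p (dL u.1, dL u.2))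
    (hUdga : IsDGAlgebra k (SDUEnv k L 𝒧 lb p) ℬU DU) :
    ∃ Φ : UEA k (GradedSymAlg k L 𝒧) 𝒮 brS p →ₐ[k] SDUEnv k L 𝒧 lb p,
      Function.Bijective Φ ∧
      (∀ (i : ℤ) (x : UEA k (GradedSymAlg k L 𝒧) 𝒮 brS p), x ∈ ℬS i → Φ x ∈ ℬU i) ∧
      (∀ x : UEA k (GradedSymAlg k L 𝒧) 𝒮 brS p, Φ (DS x) = DU (Φ x)) ∧
      (∀ a : L, Φ (ueM k (GradedSymAlg k L 𝒧) 𝒮 brS p (gsymι k L 𝒧 a)) =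
        sdι k L 𝒧 lb p (a, 0)) ∧
      (∀ a : L, Φ (ueH k (GradedSymAlg k L 𝒧) 𝒮 brS p (gsymι k L 𝒧 a)) =
        sdι k L 𝒧 lb p (0, a)) := by
  have hSdga : IsDGAlgebra k (GradedSymAlg k L 𝒧) 𝒮 dS :=
    ⟨inferInstance, ⟨inferInstance⟩, hS.d_mem, hS.d_sq, hS.d_mul⟩
  have hS1 : (1 : GradedSymAlg k L 𝒧) ∈ 𝒮 0 := SetLike.GradedOne.one_mem
  have hBUl {i : ℤ} {x : L} (hx : x ∈ 𝒧 i) : sdι k L 𝒧 lb p (x, 0) ∈ ℬU i :=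
    hBU i x 0 hx (zero_mem _)
  have hBUr {i : ℤ} {x : L} (hx : x ∈ 𝒧 i) : sdι k L 𝒧 lb p (0, x) ∈ ℬU (i + p) :=
    hBU (i + p) 0 x (zero_mem _) (by rwa [add_sub_cancel_right])
  -- the images `M` and `H` in `U(L ⋊ L)` of the two copies of `S(L)`
  obtain ⟨M, hMι⟩ : ∃ M : GradedSymAlg k L 𝒧 →ₐ[k] SDUEnv k L 𝒧 lb p,
      ∀ x, M (gsymι k L 𝒧 x) = sdι k L 𝒧 lb p (x, 0) :=
    ⟨gsymLift (sdι k L 𝒧 lb p ∘ₗ LinearMap.inl k L L) (fun i j x y hx hy => by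
      simpa [Prod.mk_zero_zero] using
        sdι_mul (lb := lb) (p := p) hx (zero_mem _) hy (zero_mem _)), fun x => by simp⟩
  obtain ⟨H, hHι, hHmul⟩ := exists_gsym_derivation 𝒮 hmem
    (fun i j a ha b hb => hS.comm i j a b ha hb) M (sdι k L 𝒧 lb p ∘ₗ LinearMap.inr k L L)
  replace hHι (x : L) : H (gsymι k L 𝒧 x) = sdι k L 𝒧 lb p (0, x) := hHι x
  have hH1 : H 1 = 0 := by simpa using hHmul 0 0 1 hS1 1 hS1
  have hbr1 {i : ℤ} {a} (ha : a ∈ 𝒮 i) : brS a 1 = 0 := by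
    simpa using hbider₁ i 0 0 a 1 1 ha hS1 hS1
  have h1br {i : ℤ} {a} (ha : a ∈ 𝒮 i) : brS 1 a = 0 := by
    simpa using hbider₂ 0 0 i 1 1 a hS1 hS1 ha
  -- the relation for `M {a, b}`
  have hMbrι {i j : ℤ} {x y : L} (hx : x ∈ 𝒧 i) (hy : y ∈ 𝒧 j) :
      M (brS (gsymι k L 𝒧 x) (gsymι k L 𝒧 y)) = H (gsymι k L 𝒧 x) * M (gsymι k L 𝒧 y) -
        ((-1 : k) ^ ((i + p) * j)) • (M (gsymι k L 𝒧 y) * H (gsymι k L 𝒧 x)) := by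
    have h := sdι_mul (lb := lb) (p := p) (m := i + p) (x := 0) (zero_mem _)
      (by rwa [add_sub_cancel_right]) hy (zero_mem _)
    rw [hbrS, hMι, hHι, hMι, h]
    simp
  have hMbrx {i j : ℤ} {x : L} (hx : x ∈ 𝒧 i) {b} (hb : b ∈ 𝒮 j) :
      M (brS (gsymι k L 𝒧 x) b) = H (gsymι k L 𝒧 x) * M b -
        ((-1 : k) ^ ((i + p) * j)) • (M b * H (gsymι k L 𝒧 x)) :=
    gsym_eq_of_homogeneous 𝒮 hmem (fun _ => M.toLinearMap ∘ₗ brS (gsymι k L 𝒧 x))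
      (fun j => LinearMap.mulLeft k (H (gsymι k L 𝒧 x)) ∘ₗ M.toLinearMap -
        ((-1 : k) ^ ((i + p) * j)) • (LinearMap.mulRight k (H (gsymι k L 𝒧 x)) ∘ₗ M.toLinearMap))
      (by simp [hbr1 (hmem i x hx)])
      (fun j l y hy c hc hc' => map_br_mul_right
        (hbider₁ _ _ _ _ _ _ (hmem i x hx) (hmem j y hy) hc) (hMbrι hx hy) hc') hb
  have hMbr (i j : ℤ) (a) (ha : a ∈ 𝒮 i) (b) (hb : b ∈ 𝒮 j) :
      M (brS a b) = H a * M b - ((-1 : k) ^ ((i + p) * j)) • (M b * H a) :=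
    gsym_eq_of_homogeneous 𝒮 hmem (fun _ => M.toLinearMap ∘ₗ brS.flip b)
      (fun i => LinearMap.mulRight k (M b) ∘ₗ H -
        ((-1 : k) ^ ((i + p) * j)) • (LinearMap.mulLeft k (M b) ∘ₗ H))
      (by simp [h1br hb, hH1])
      (fun i l x hx c hc hc' => map_br_mul_left (hS.comm _ _ _ _ (hmem i x hx) hb)
        (hS.comm _ _ _ _ hc hb) (hHmul _ _ _ (hmem i x hx) _ hc)
        (hbider₂ _ _ _ _ _ _ (hmem i x hx) hc hb) (hMbrx hx hb) hc') ha
  -- the relation for `H {a, b}`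
  have hHbrι {i j : ℤ} {x y : L} (hx : x ∈ 𝒧 i) (hy : y ∈ 𝒧 j) :
      H (brS (gsymι k L 𝒧 x) (gsymι k L 𝒧 y)) = H (gsymι k L 𝒧 x) * H (gsymι k L 𝒧 y) -
        ((-1 : k) ^ ((i + p) * (j + p))) • (H (gsymι k L 𝒧 y) * H (gsymι k L 𝒧 x)) := by
    have h := sdι_mul (lb := lb) (p := p) (m := i + p) (n := j + p) (x := 0) (y := 0) (zero_mem _)
      (by rwa [add_sub_cancel_right]) (zero_mem _) (by rwa [add_sub_cancel_right])
    rw [hbrS, hHι, hHι, hHι, h]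
    simp
  have hHbr_of {i : ℤ} {a} (ha : a ∈ 𝒮 i)
      (hx : ∀ j, ∀ x ∈ 𝒧 j, H (brS a (gsymι k L 𝒧 x)) = H a * H (gsymι k L 𝒧 x) -
        ((-1 : k) ^ ((i + p) * (j + p))) • (H (gsymι k L 𝒧 x) * H a)) {j : ℤ} {b}
      (hb : b ∈ 𝒮 j) :
      H (brS a b) = H a * H b - ((-1 : k) ^ ((i + p) * (j + p))) • (H b * H a) :=
    gsym_eq_of_homogeneous 𝒮 hmem (fun _ => H ∘ₗ brS a)
      (fun j => LinearMap.mulLeft k (H a) ∘ₗ H -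
        ((-1 : k) ^ ((i + p) * (j + p))) • (LinearMap.mulRight k (H a) ∘ₗ H))
      (by simp [hbr1 ha, hH1])
      (fun j l x hx' c hc hc' => hamiltonian_br_mul_right hHmul (hmem j x hx') hc
        (hS.br_mem _ _ _ _ ha (hmem j x hx')) (hS.br_mem _ _ _ _ ha hc)
        (hbider₁ _ _ _ _ _ _ ha (hmem j x hx') hc) (hMbr _ _ _ ha _ (hmem j x hx'))
        (hMbr _ _ _ ha _ hc) (hx j x hx') hc') hb
  have hHbr (i j : ℤ) (a) (ha : a ∈ 𝒮 i) (b) (hb : b ∈ 𝒮 j) :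
      H (brS a b) = H a * H b - ((-1 : k) ^ ((i + p) * (j + p))) • (H b * H a) :=
    hHbr_of ha (fun j x hx => hamiltonian_br_symm (hS.antisymm _ _ _ _ ha (hmem j x hx))
      (hHbr_of (hmem j x hx) (fun l y hy => hHbrι hx hy) ha)) hb
  -- compatibility of `M` and `H` with degrees and differentials
  obtain ⟨hMmem, hMd⟩ := hSdga.algHom_of_adjoin_eq_top hUdga M
    (G := fun i => gsymι k L 𝒧 '' (𝒧 i : Set L))
    (by rintro i _ ⟨x, hx, rfl⟩; exact hmem i x hx) adjoin_iUnion_gsymι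
    (by rintro i _ ⟨x, hx, rfl⟩; rw [hMι]; exact hBUl hx)
    (by rintro i _ ⟨x, hx, rfl⟩; simp [hdS, hMι, hDU])
  have hHmem (i : ℤ) (a) (ha : a ∈ 𝒮 i) : H a ∈ ℬU (i + p) :=
    gsym_mem_of_homogeneous 𝒮 hmem (fun i => (ℬU (i + p)).comap H) (by simp [hH1])
      (fun i j x hx b hb hb' => by
        have h1 := hUdga.graded_monoid.mul_mem (hMmem i _ (hmem i x hx)) hb'
        have h2 := hUdga.graded_monoid.mul_mem (hMmem j b hb) (hBUr hx)
        rw [← add_assoc] at h1 h2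
        rw [add_comm j i] at h2
        rw [Submodule.mem_comap, hHmul i j _ (hmem i x hx) b hb, hHι]
        exact add_mem h1 (Submodule.smul_mem _ _ h2)) ha
  have hHd (a) : H (dS a) = DU (H a) := by
    refine LinearMap.congr_fun (linearMap_eq_of_homogeneous 𝒮 (f := H ∘ₗ dS) (g := DU ∘ₗ H)
      fun i a ha => gsym_eq_of_homogeneous 𝒮 hmem (fun _ => H ∘ₗ dS) (fun _ => DU ∘ₗ H)
        (by simp [hSdga.d_one, hH1]) (fun i j x hx b hb hb' => ?_) ha) a
    exact hamiltonian_differential_mul hHmul hUdga.d_mul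
      (hS.d_mul i j _ b (hmem i x hx) hb) (hmem i x hx) hb (hS.d_mem _ _ (hmem i x hx))
      (hS.d_mem _ _ hb) (hMmem _ _ (hmem i x hx)) (hMmem _ _ hb) (hHmem _ _ (hmem i x hx))
      (hHmem _ _ hb) (hMd _) (hMd _) (by simp [hdS, hHι, hDU]) hb'
  obtain ⟨Φ, hΦM, hΦH⟩ := exists_ueLift M H hHbr hHmul hMbr
  -- the inverse homomorphism
  obtain ⟨Ψ, hΨ⟩ := exists_sdLift (𝒧 := 𝒧) (lb := lb) (p := p)
    (ueM k (GradedSymAlg k L 𝒧) 𝒮 brS p ∘ₗ gsymι k L 𝒧)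
    (ueH k (GradedSymAlg k L 𝒧) 𝒮 brS p ∘ₗ gsymι k L 𝒧)
    (fun i j x hx y hy => by
      simp only [LinearMap.comp_apply, ← ueM_mul, gsymι_mul_comm hx hy, map_smul])
    (fun i j x hx y hy => by
      simp only [LinearMap.comp_apply, ← hbrS, ueH_br (hmem i x hx) (hmem j y hy)])
    (fun i j x hx y hy => by
      simp only [LinearMap.comp_apply, ← hbrS, ueM_br (hmem i x hx) (hmem j y hy)])
  have hΨM (a) : Ψ (M a) = ueM k (GradedSymAlg k L 𝒧) 𝒮 brS p a :=
    DFunLike.congr_fun (gsym_algHom_ext (f := Ψ.comp M) (g := ueMHom)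
      fun x => by
        change Ψ (M (gsymι k L 𝒧 x)) = ueM k (GradedSymAlg k L 𝒧) 𝒮 brS p (gsymι k L 𝒧 x)
        simp [hMι, hΨ]) a
  have hΨH (a) : Ψ (H a) = ueH k (GradedSymAlg k L 𝒧) 𝒮 brS p a := by
    refine LinearMap.congr_fun (linearMap_eq_of_homogeneous 𝒮 (f := Ψ.toLinearMap ∘ₗ H)
      fun i a ha => gsym_eq_of_homogeneous 𝒮 hmem (fun _ => Ψ.toLinearMap ∘ₗ H)
        (fun _ => ueH k (GradedSymAlg k L 𝒧) 𝒮 brS p) (by simp [hH1, ueH_one])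
        (fun i j x hx b hb hb' => ?_) ha) a
    replace hb' : Ψ (H b) = ueH k (GradedSymAlg k L 𝒧) 𝒮 brS p b := hb'
    simp [hHmul i j _ (hmem i x hx) b hb, ueH_mul (hmem i x hx) hb, hΨM, hb', hHι, hΨ]
  have hΨΦ (x) : Ψ (Φ x) = x :=
    DFunLike.congr_fun (ue_algHom_ext (f := Ψ.comp Φ) (g := AlgHom.id k _)
      (fun a => by simp [hΦM, hΨM]) (fun a => by simp [hΦH, hΨH])) x
  have hΦΨ (u) : Φ (Ψ u) = u :=
    DFunLike.congr_fun (sd_algHom_ext (f := Φ.comp Ψ) (g := AlgHom.id k _)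
      (fun a => by simp [hΨ, hΦM, hMι]) (fun a => by simp [hΨ, hΦH, hHι])) u
  obtain ⟨hΦmem, hΦd⟩ := hueS.algHom_of_generators hUdga Φ
    (fun i a ha => by rw [hΦM]; exact hMmem i a ha)
    (fun i a ha => by rw [hΦH]; exact hHmem i a ha)
    (fun a => by rw [hΦM, hΦM, hMd]) (fun a => by rw [hΦH, hΦH, hHd])
  exact ⟨Φ, Function.bijective_iff_has_inverse.2 ⟨Ψ, hΨΦ, hΦΨ⟩, hΦmem, hΦd,
    fun a => by rw [hΦM, hMι], fun a => by rw [hΦH, hHι]⟩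

end
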